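/- Let M be a γ-matching of a link stream L, and suppose every γ-edge of L contains at least one temporal vertex of bot(M). Then every γ-matching M' of L satisfies |M'| ≤ 2|M|. -/

import Mathlib

/-- `GEdge γ E e` : the tuple `e = (t,u,v)` defines a γ-edge of the link stream
with timed-edge relation `E` : `u ≠ v` and all timed edges `(s,{u,v})`,
`s ∈ [t, t+γ-1]`, belong to the link stream. -/
def GEdge {V : Type*} (γ : ℕ) (E : ℕ → V → V → Prop) (e : ℕ × V × V) : Prop :=
  e.2.1 ≠ e.2.2 ∧ ∀ s ∈ Finset.Icc e.1 (e.1 + γ - 1), E s e.2.1 e.2.2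

/-- The γ-edge `e = (t,u,v)` contains the temporal vertex `p = (s,w)`. -/
def TV {V : Type*} (γ : ℕ) (e : ℕ × V × V) (p : ℕ × V) : Prop :=
  p.1 ∈ Finset.Icc e.1 (e.1 + γ - 1) ∧ (p.2 = e.2.1 ∨ p.2 = e.2.2)

/-- Two γ-edges are independent: no temporal vertex is contained in both. -/
def Indep {V : Type*} (γ : ℕ) (e e' : ℕ × V × V) : Prop :=
  ∀ p : ℕ × V, ¬ (TV γ e p ∧ TV γ e' p)

/-- `M` is a γ-matching of the link stream with timed-edge relation `E`. -/
def IsMatching {V : Type*} (γ : ℕ) (E : ℕ → V → V → Prop)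
    (M : Finset (ℕ × V × V)) : Prop :=
  (∀ e ∈ M, GEdge γ E e) ∧ ∀ e ∈ M, ∀ e' ∈ M, e ≠ e' → Indep γ e e'

/-- The bottom temporal vertices of `M`. -/
def botM {V : Type*} [DecidableEq V] (γ : ℕ) (M : Finset (ℕ × V × V)) :
    Finset (ℕ × V) :=
  M.biUnion fun e => {(e.1 + γ - 1, e.2.1), (e.1 + γ - 1, e.2.2)}

theorem card_botM_le {V : Type*} [DecidableEq V] (γ : ℕ) (M : Finset (ℕ × V × V)) :
    (botM γ M).card ≤ 2 * M.card := by
  rw [mul_comm]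
  exact Finset.card_biUnion_le_card_mul _ _ _ fun _ _ => Finset.card_le_two

/-- If every element of a γ-matching contains a temporal vertex of `B`, then the matching has at
most `|B|` elements. -/
theorem IsMatching.card_le_of_cover {V : Type*} {γ : ℕ} {E : ℕ → V → V → Prop}
    {M : Finset (ℕ × V × V)} (hM : IsMatching γ E M) {B : Finset (ℕ × V)}
    (hB : ∀ e ∈ M, ∃ p ∈ B, TV γ e p) : M.card ≤ B.card :=
  Finset.card_le_card_of_forall_subsingleton (TV γ) hB fun p _ e he e' he' => by
    by_contra hne
    exact hM.2 e he.1 e' he'.1 hne p ⟨he.2, he'.2⟩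

/-- If every γ-edge of the link stream contains a bottom temporal vertex of the
γ-matching `M`, then every γ-matching `M'` satisfies `|M'| ≤ 2|M|`. -/
theorem bot_cover_two_approx {V : Type*} [DecidableEq V] (γ : ℕ) (hγ : 1 ≤ γ)
    (E : ℕ → V → V → Prop) (M M' : Finset (ℕ × V × V))
    (hM : IsMatching γ E M) (hM' : IsMatching γ E M')
    (hcover : ∀ e, GEdge γ E e → ∃ p ∈ botM γ M, TV γ e p) :
    M'.card ≤ 2 * M.card := by
  exact (hM'.card_le_of_cover fun e he => hcover e (hM'.1 e he)).trans (card_botM_le γ M)
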